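/- Let S be a finite meet-semilattice with least element 0 and greatest element 1 of order n ≥ 4 having exactly one atom a. Then for every s ∈ S with s ≠ 0 and s ≠ a, |cov₁(s)| ≤ (n−2)² + 2. -/

import Mathlib

/-- `cov₁ s` is the set of first-kind one-variable equations `x ⊓ a = x ⊓ a′`
(given as ordered pairs `(a, a′)`) satisfied by `s`. -/
def cov₁ {S : Type*} [SemilatticeInf S] (s : S) : Set (S × S) :=
  {p : S × S | s ⊓ p.1 = s ⊓ p.2}

/-- In a finite order with a unique atom, that atom lies below every nonzero element. -/
lemma le_of_unique_atom {S : Type*} [Finite S] [PartialOrder S] [OrderBot S] {a : S}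
    (huniq : ∀ b : S, IsAtom b → b = a) {t : S} (ht : t ≠ ⊥) : a ≤ t := by
  obtain ⟨b, hb, hbt⟩ := (eq_bot_or_exists_atom_le t).resolve_left ht
  exact huniq b hb ▸ hbt

/-- If `S` (of order `n ≥ 4`) has exactly one atom `a`, then for every `s ∉ {0, a}`,
`|cov₁ s| ≤ (n−2)² + 2`. -/
theorem stmt_16 (S : Type*) [Fintype S] [SemilatticeInf S] [OrderBot S] [OrderTop S]
    (hn : 4 ≤ Fintype.card S)
    (a : S) (ha : IsAtom a) (huniq : ∀ b : S, IsAtom b → b = a)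
    (s : S) (hs0 : s ≠ ⊥) (hsa : s ≠ a) :
    Nat.card (cov₁ s) ≤ (Fintype.card S - 2) ^ 2 + 2 := by
  classical
  set A : Finset S := Finset.univ.filter fun t => t ≠ ⊥ ∧ s ⊓ t = a with hA
  set B : Finset S := Finset.univ.filter fun t => t ≠ ⊥ ∧ s ⊓ t ≠ a with hB
  have has : a ≤ s := le_of_unique_atom huniq hs0
  have hinf {t : S} (h : s ⊓ t = ⊥) : t = ⊥ := by
    by_contra ht
    exact ha.1 (le_bot_iff.1 (h ▸ le_inf has (le_of_unique_atom huniq ht)))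
  have hsub : cov₁ s ⊆ ((({(⊥, ⊥)} ∪ A ×ˢ A) ∪ B ×ˢ B : Finset (S × S)) : Set (S × S)) := by
    rintro ⟨x, y⟩ hxy
    have hxy' : s ⊓ x = s ⊓ y := hxy
    have hx : x = ⊥ → y = ⊥ := fun h => hinf (by rw [← hxy', h, inf_bot_eq])
    have hy : y = ⊥ → x = ⊥ := fun h => hinf (by rw [hxy', h, inf_bot_eq])
    simp only [Finset.coe_union, Set.mem_union, Finset.mem_coe, Finset.mem_singleton,
      Finset.mem_product, Prod.mk.injEq, hA, hB, Finset.mem_filter, Finset.mem_univ, true_and,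
      hxy']
    tauto
  have hcard : Nat.card (cov₁ s) ≤ 1 + A.card * A.card + B.card * B.card := by
    rw [Nat.card_coe_set_eq]
    refine (Set.ncard_le_ncard hsub).trans ?_
    rw [Set.ncard_coe_finset]
    refine (Finset.card_union_le _ _).trans ?_
    rw [Finset.card_product B B]
    gcongr
    refine (Finset.card_union_le _ _).trans ?_
    rw [Finset.card_product, Finset.card_singleton]
  have hApos : 0 < A.card := Finset.card_pos.2 ⟨a, by simp [hA, ha.1, has]⟩
  have hBpos : 0 < B.card := Finset.card_pos.2 ⟨s, by simp [hB, hs0, hsa]⟩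
  have hsum : A.card + B.card + 1 = Fintype.card S := by
    have hdisj : Disjoint A B := by
      rw [Finset.disjoint_left]
      simp +contextual [hA, hB]
    have hun : A ∪ B = Finset.univ.erase ⊥ := by
      ext t
      simp only [hA, hB, Finset.mem_union, Finset.mem_filter, Finset.mem_univ, true_and,
        Finset.mem_erase, and_true]
      tauto
    rw [← Finset.card_union_of_disjoint hdisj, hun, Finset.card_erase_add_one (Finset.mem_univ _),
      Finset.card_univ]
  refine hcard.trans ?_
  obtain ⟨k, hk⟩ := Nat.exists_eq_add_of_lt hApos
  obtain ⟨m, hm⟩ := Nat.exists_eq_add_of_lt hBpos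
  have hn2 : Fintype.card S - 2 = k + m + 1 := by omega
  rw [hn2, hk, hm]
  nlinarith [Nat.zero_le (k * m)]
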